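/- The generalized Zamolodchikov–Fateev (gZF) parameters satisfy the first constraint set of the coordinate Bethe ansatz: for all nonzero complex z1, z2, z3 with Λ(z_i,z_j) ≠ 0 for all i ≠ j, Σ_{σ ∈ S3} A_σ · z_{σ(3)} · [ N(z_{σ(1)},z_{σ(2)}) · ( X21 − q·z_{σ(1)} − q·z_{σ(2)} − p·z_{σ(1)}^{-1} − p·z_{σ(2)}^{-1} − p·z_{σ(3)}^{-1} + tp·z_{σ(1)}^{-1}·z_{σ(2)}^{-1} ) + N(z_{σ(2)},z_{σ(3)})·s3·z_{σ(2)} + t2·z_{σ(1)}^{-1} ] = 0, where the gZF values are X21 = (3p² − s1·t2)/tp and s3 = p³/tp². -/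

import Mathlib

noncomputable section

/-- The amplitude `Λ(z1, z2)` of the coordinate Bethe ansatz. -/
def Lam (p q t1 t2 s1 s2 tp sp X11 Y z1 z2 : ℂ) : ℂ :=
  z2 * (s1 + s2 * z1 * z2) * (t2 + t1 * z1 * z2) -
    (Y * z1 * z2 - q * z1 * z2 * (z1 + z2) - p * (z1 + z2) + sp * z1 ^ 2 * z2 ^ 2 + tp) *
      (X11 * z2 - q * z1 * z2 - p)

/-- The scattering amplitude `S(z1, z2) = -Λ(z1,z2)/Λ(z2,z1)`. -/
def Sc (p q t1 t2 s1 s2 tp sp X11 Y z1 z2 : ℂ) : ℂ :=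
  -(Lam p q t1 t2 s1 s2 tp sp X11 Y z1 z2 / Lam p q t1 t2 s1 s2 tp sp X11 Y z2 z1)

/-- The decay coefficient `N(z1, z2)`. -/
def Nc (p q t1 t2 s1 s2 tp sp X11 Y z1 z2 : ℂ) : ℂ :=
  (z1 - z2) * (p + q * z1 * z2) * (t2 + t1 * z1 * z2) /
    (2 * Lam p q t1 t2 s1 s2 tp sp X11 Y z2 z1)

/-- The coefficient `A_σ`: the product of `S(z_a, z_b)` over the pairs `a < b`
inverted by the permutation `σ` (i.e. with `σ⁻¹ a > σ⁻¹ b`). -/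
def Aperm (S : ℂ → ℂ → ℂ) (z : Fin 3 → ℂ) (σ : Equiv.Perm (Fin 3)) : ℂ :=
  ∏ pr ∈ Finset.univ.filter
      (fun pr : Fin 3 × Fin 3 => pr.1 < pr.2 ∧ σ⁻¹ pr.2 < σ⁻¹ pr.1),
    S (z pr.1) (z pr.2)

/-- The reduced amplitude of the gZF family, in the rescaled variables `w = p z / tp`
and with `c = s1 t2 / p²`. -/
def reducedLam (c w₁ w₂ : ℂ) : ℂ := 1 + w₁ * w₂ - w₁ + (c - 1) * w₂

section GZF

variable {p tp : ℂ} (t2 s1 : ℂ)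

lemma Lam_gZF (hp : p ≠ 0) (htp : tp ≠ 0) (w₁ w₂ : ℂ) :
    Lam p (p ^ 3 / tp ^ 2) (p ^ 2 * t2 / tp ^ 2) t2 s1 (p ^ 2 * s1 / tp ^ 2) tp (p ^ 4 / tp ^ 3)
        0 (2 * p ^ 2 / tp) (tp / p * w₁) (tp / p * w₂) =
      tp * p * (1 + w₁ * w₂) ^ 2 * reducedLam (s1 * t2 / p ^ 2) w₁ w₂ := by
  unfold Lam reducedLam
  field_simp
  ring

lemma Sc_gZF (hp : p ≠ 0) (htp : tp ≠ 0) (w₁ w₂ : ℂ) (h : 1 + w₁ * w₂ ≠ 0) :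
    Sc p (p ^ 3 / tp ^ 2) (p ^ 2 * t2 / tp ^ 2) t2 s1 (p ^ 2 * s1 / tp ^ 2) tp (p ^ 4 / tp ^ 3)
        0 (2 * p ^ 2 / tp) (tp / p * w₁) (tp / p * w₂) =
      -(reducedLam (s1 * t2 / p ^ 2) w₁ w₂ / reducedLam (s1 * t2 / p ^ 2) w₂ w₁) := by
  rw [Sc, Lam_gZF t2 s1 hp htp, Lam_gZF t2 s1 hp htp, mul_comm w₂ w₁, mul_div_mul_left]
  exact mul_ne_zero (mul_ne_zero htp hp) (pow_ne_zero 2 h)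

lemma Nc_gZF (hp : p ≠ 0) (htp : tp ≠ 0) (w₁ w₂ : ℂ) (h : 1 + w₁ * w₂ ≠ 0) :
    Nc p (p ^ 3 / tp ^ 2) (p ^ 2 * t2 / tp ^ 2) t2 s1 (p ^ 2 * s1 / tp ^ 2) tp (p ^ 4 / tp ^ 3)
        0 (2 * p ^ 2 / tp) (tp / p * w₁) (tp / p * w₂) =
      t2 / (2 * p) * ((w₁ - w₂) / reducedLam (s1 * t2 / p ^ 2) w₂ w₁) := by
  rw [Nc, Lam_gZF t2 s1 hp htp, mul_comm w₂ w₁]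
  have hnum : (tp / p * w₁ - tp / p * w₂) * (p + p ^ 3 / tp ^ 2 * (tp / p * w₁) * (tp / p * w₂)) *
      (t2 + p ^ 2 * t2 / tp ^ 2 * (tp / p * w₁) * (tp / p * w₂)) =
      (tp * p * (1 + w₁ * w₂) ^ 2) * (t2 / p * (w₁ - w₂)) := by
    field_simp
  rw [hnum, mul_left_comm 2, mul_div_mul_left _ _
    (mul_ne_zero (mul_ne_zero htp hp) (pow_ne_zero 2 h)), div_mul_div_comm, div_mul_eq_mul_div,
    div_div]
  congr 1
  ring

end GZF

lemma sum_perm_fin_three (f : Equiv.Perm (Fin 3) → ℂ) :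
    ∑ σ, f σ = f 1 + f (Equiv.swap 0 1) + f (Equiv.swap 1 2) + f (Equiv.swap 0 2) +
      f (finRotate 3) + f (finRotate 3)⁻¹ := by
  have huniv : (Finset.univ : Finset (Equiv.Perm (Fin 3))) =
      {1, Equiv.swap 0 1, Equiv.swap 1 2, Equiv.swap 0 2, finRotate 3, (finRotate 3)⁻¹} := by
    decide
  rw [huniv, Finset.sum_insert (by decide), Finset.sum_insert (by decide),
    Finset.sum_insert (by decide), Finset.sum_insert (by decide), Finset.sum_insert (by decide),
    Finset.sum_singleton]
  ring

section Aperm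

variable (S : ℂ → ℂ → ℂ) (z : Fin 3 → ℂ)

lemma Aperm_one : Aperm S z 1 = 1 := by
  rw [Aperm, show Finset.univ.filter (fun pr : Fin 3 × Fin 3 => pr.1 < pr.2 ∧
    (1 : Equiv.Perm (Fin 3))⁻¹ pr.2 < (1 : Equiv.Perm (Fin 3))⁻¹ pr.1) = ∅ by decide]
  simp

lemma Aperm_swap_zero_one : Aperm S z (Equiv.swap 0 1) = S (z 0) (z 1) := by
  rw [Aperm, show Finset.univ.filter (fun pr : Fin 3 × Fin 3 => pr.1 < pr.2 ∧
    (Equiv.swap 0 1)⁻¹ pr.2 < (Equiv.swap 0 1)⁻¹ pr.1) =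
    {(0, 1)} by decide]
  simp

lemma Aperm_swap_one_two : Aperm S z (Equiv.swap 1 2) = S (z 1) (z 2) := by
  rw [Aperm, show Finset.univ.filter (fun pr : Fin 3 × Fin 3 => pr.1 < pr.2 ∧
    (Equiv.swap 1 2)⁻¹ pr.2 < (Equiv.swap 1 2)⁻¹ pr.1) =
    {(1, 2)} by decide]
  simp

lemma Aperm_swap_zero_two : Aperm S z (Equiv.swap 0 2) =
    S (z 0) (z 1) * S (z 0) (z 2) * S (z 1) (z 2) := by
  rw [Aperm, show Finset.univ.filter (fun pr : Fin 3 × Fin 3 => pr.1 < pr.2 ∧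
    (Equiv.swap 0 2)⁻¹ pr.2 < (Equiv.swap 0 2)⁻¹ pr.1) =
    {(0, 1), (0, 2), (1, 2)} by decide]
  simp [Finset.prod_insert, mul_assoc]

lemma Aperm_finRotate : Aperm S z (finRotate 3) = S (z 0) (z 1) * S (z 0) (z 2) := by
  rw [Aperm, show Finset.univ.filter (fun pr : Fin 3 × Fin 3 => pr.1 < pr.2 ∧
    (finRotate 3)⁻¹ pr.2 < (finRotate 3)⁻¹ pr.1) =
    {(0, 1), (0, 2)} by decide]
  simp [Finset.prod_insert]

lemma Aperm_finRotate_inv : Aperm S z (finRotate 3)⁻¹ = S (z 0) (z 2) * S (z 1) (z 2) := by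
  rw [Aperm, show Finset.univ.filter (fun pr : Fin 3 × Fin 3 => pr.1 < pr.2 ∧
    (finRotate 3)⁻¹⁻¹ pr.2 < (finRotate 3)⁻¹⁻¹ pr.1) =
    {(0, 2), (1, 2)} by decide]
  simp [Finset.prod_insert]

end Aperm

/-- The factor multiplying `A_σ` in the rescaled constraint, up to an overall constant. -/
def reducedTerm (c w₁ w₂ w₃ : ℂ) : ℂ :=
  w₃ * ((w₁ - w₂) / reducedLam c w₂ w₁ *
      (3 - c - w₁ - w₂ - w₁⁻¹ - w₂⁻¹ - w₃⁻¹ + w₁⁻¹ * w₂⁻¹) +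
    (w₂ - w₃) / reducedLam c w₃ w₂ * w₂ + 2 * w₁⁻¹)

lemma reduced_constraint (c x y z : ℂ) (hx : x ≠ 0) (hy : y ≠ 0) (hz : z ≠ 0)
    (hxy : reducedLam c x y ≠ 0) (hyx : reducedLam c y x ≠ 0) (hxz : reducedLam c x z ≠ 0)
    (hzx : reducedLam c z x ≠ 0) (hyz : reducedLam c y z ≠ 0) (hzy : reducedLam c z y ≠ 0) :
    reducedTerm c x y z +
      -(reducedLam c x y / reducedLam c y x) * reducedTerm c y x z +
      -(reducedLam c y z / reducedLam c z y) * reducedTerm c x z y +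
      -(reducedLam c x y / reducedLam c y x) * -(reducedLam c x z / reducedLam c z x) *
        -(reducedLam c y z / reducedLam c z y) * reducedTerm c z y x +
      -(reducedLam c x y / reducedLam c y x) *
        -(reducedLam c x z / reducedLam c z x) * reducedTerm c y z x +
      -(reducedLam c x z / reducedLam c z x) *
        -(reducedLam c y z / reducedLam c z y) * reducedTerm c z x y = 0 := by
  unfold reducedTerm
  field_simp
  unfold reducedLam
  ring

/-- The gZF parameters satisfy the first constraint set (`E21`) of the
coordinate Bethe ansatz. -/
theorem statement8 (p tp t2 s1 : ℂ)
    (hp : p ≠ 0) (htp : tp ≠ 0) (ht2 : t2 ≠ 0) (hs1 : s1 ≠ 0)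
    (q t1 t3 s2 s3 sp X11 Y X12 X21 X22 : ℂ)
    (hq : q = p ^ 3 / tp ^ 2) (hs3 : s3 = p ^ 3 / tp ^ 2)
    (ht1 : t1 = p ^ 2 * t2 / tp ^ 2) (ht3 : t3 = p)
    (hs2 : s2 = p ^ 2 * s1 / tp ^ 2) (hsp : sp = p ^ 4 / tp ^ 3)
    (hX11 : X11 = 0) (hY : Y = 2 * p ^ 2 / tp)
    (hX12 : X12 = (3 * p ^ 2 - s1 * t2) / tp) (hX21 : X21 = (3 * p ^ 2 - s1 * t2) / tp)
    (hX22 : X22 = (4 * p ^ 2 - 2 * s1 * t2) / tp)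
    (z : Fin 3 → ℂ) (hz : ∀ i, z i ≠ 0)
    (hLam : ∀ i j, i ≠ j → Lam p q t1 t2 s1 s2 tp sp X11 Y (z i) (z j) ≠ 0) :
    ∑ σ : Equiv.Perm (Fin 3),
      Aperm (Sc p q t1 t2 s1 s2 tp sp X11 Y) z σ * z (σ 2) *
        (Nc p q t1 t2 s1 s2 tp sp X11 Y (z (σ 0)) (z (σ 1)) *
            (X21 - q * z (σ 0) - q * z (σ 1) - p * (z (σ 0))⁻¹ - p * (z (σ 1))⁻¹ -
              p * (z (σ 2))⁻¹ + tp * (z (σ 0))⁻¹ * (z (σ 1))⁻¹) +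
          Nc p q t1 t2 s1 s2 tp sp X11 Y (z (σ 1)) (z (σ 2)) * s3 * z (σ 1) +
          t2 * (z (σ 0))⁻¹) = 0 := by
  clear ht3
  subst hq hs3 ht1 hs2 hsp hX11 hY hX12 hX21 hX22
  obtain ⟨w, rfl⟩ : ∃ w : Fin 3 → ℂ, z = fun i => tp / p * w i :=
    ⟨fun i => p / tp * z i, by ext i; field_simp⟩
  have hw (i) : w i ≠ 0 := right_ne_zero_of_mul (hz i)
  simp only [Lam_gZF t2 s1 hp htp] at hLam
  have hL (i j) (hij : i ≠ j) : reducedLam (s1 * t2 / p ^ 2) (w i) (w j) ≠ 0 :=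
    right_ne_zero_of_mul (hLam i j hij)
  have h1 (i j) (hij : i ≠ j) : 1 + w i * w j ≠ 0 :=
    ne_zero_pow two_ne_zero (right_ne_zero_of_mul (left_ne_zero_of_mul (hLam i j hij)))
  have hS (i j) (hij : i ≠ j) := Sc_gZF t2 s1 hp htp (w i) (w j) (h1 i j hij)
  have hterm (σ : Equiv.Perm (Fin 3)) (A : ℂ) :
      A * (tp / p * w (σ 2)) *
        (Nc p (p ^ 3 / tp ^ 2) (p ^ 2 * t2 / tp ^ 2) t2 s1 (p ^ 2 * s1 / tp ^ 2) tp
            (p ^ 4 / tp ^ 3) 0 (2 * p ^ 2 / tp) (tp / p * w (σ 0)) (tp / p * w (σ 1)) *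
            ((3 * p ^ 2 - s1 * t2) / tp - p ^ 3 / tp ^ 2 * (tp / p * w (σ 0)) -
              p ^ 3 / tp ^ 2 * (tp / p * w (σ 1)) - p * (tp / p * w (σ 0))⁻¹ -
              p * (tp / p * w (σ 1))⁻¹ - p * (tp / p * w (σ 2))⁻¹ +
              tp * (tp / p * w (σ 0))⁻¹ * (tp / p * w (σ 1))⁻¹) +
          Nc p (p ^ 3 / tp ^ 2) (p ^ 2 * t2 / tp ^ 2) t2 s1 (p ^ 2 * s1 / tp ^ 2) tp
            (p ^ 4 / tp ^ 3) 0 (2 * p ^ 2 / tp) (tp / p * w (σ 1)) (tp / p * w (σ 2)) *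
            (p ^ 3 / tp ^ 2) * (tp / p * w (σ 1)) +
          t2 * (tp / p * w (σ 0))⁻¹) =
      t2 / 2 * (A * reducedTerm (s1 * t2 / p ^ 2) (w (σ 0)) (w (σ 1)) (w (σ 2))) := by
    have h01 : σ 0 ≠ σ 1 := σ.injective.ne (by decide)
    have h12 : σ 1 ≠ σ 2 := σ.injective.ne (by decide)
    rw [Nc_gZF t2 s1 hp htp _ _ (h1 _ _ h01), Nc_gZF t2 s1 hp htp _ _ (h1 _ _ h12), reducedTerm]
    generalize (w (σ 0) - w (σ 1)) / reducedLam (s1 * t2 / p ^ 2) (w (σ 1)) (w (σ 0)) = N₁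
    generalize (w (σ 1) - w (σ 2)) / reducedLam (s1 * t2 / p ^ 2) (w (σ 2)) (w (σ 1)) = N₂
    have := hw (σ 0)
    have := hw (σ 1)
    have := hw (σ 2)
    field_simp
  simp only [hterm]
  rw [← Finset.mul_sum, sum_perm_fin_three, Aperm_one, Aperm_swap_zero_one, Aperm_swap_one_two,
    Aperm_swap_zero_two, Aperm_finRotate, Aperm_finRotate_inv, hS 0 1 (by decide),
    hS 0 2 (by decide), hS 1 2 (by decide)]
  have key := reduced_constraint (s1 * t2 / p ^ 2) (w 0) (w 1) (w 2) (hw 0) (hw 1) (hw 2)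
    (hL 0 1 (by decide)) (hL 1 0 (by decide)) (hL 0 2 (by decide)) (hL 2 0 (by decide))
    (hL 1 2 (by decide)) (hL 2 1 (by decide))
  refine mul_eq_zero_of_right _ ?_
  rw [one_mul]
  exact key
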